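/- arXiv:math/0605474 — 2 statements merged into one kernel-verified Lean document; each statement's English description precedes it below -/
import Mathlib

section
/- For every natural number n and every integer j with j ≡ 1 or 2 (mod 5), the number p_j(5n) of partitions of 5n with BG-rank j is divisible by 5. -/
/-- A partition, represented as a weakly decreasing list of positive integers. -/
def IsPartition (l : List ℕ) : Prop :=
  l.Pairwise (· ≥ ·) ∧ ∀ x ∈ l, 0 < x

/-- The BG-rank of a partition `λ₁ ≥ λ₂ ≥ …`:  `Σᵢ (−1)^(i+1) (λᵢ mod 2)`
(with 1-based indexing, i.e. the first part contributes with sign `+1`). -/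
def bgRank (l : List ℕ) : ℤ :=
  ∑ i ∈ Finset.range l.length, (-1 : ℤ) ^ i * ((l.getD i 0 : ℤ) % 2)

/-- `p n`, the number of partitions of `n`. -/
noncomputable def partitionCount (n : ℕ) : ℕ :=
  Nat.card {l : List ℕ // IsPartition l ∧ l.sum = n}

/-- `p_j(n)`, the number of partitions of `n` with BG-rank `j`. -/
noncomputable def pj (j : ℤ) (n : ℕ) : ℕ :=
  Nat.card {l : List ℕ // IsPartition l ∧ l.sum = n ∧ bgRank l = j}

/-- `pp n`, the number of ordered pairs of partitions of total size `n`. -/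
noncomputable def pp (n : ℕ) : ℕ :=
  ∑ k ∈ Finset.range (n + 1), partitionCount k * partitionCount (n - k)


open PowerSeries
noncomputable section
abbrev QA := PowerSeries (ZMod 5)
instance fact5 : Fact (Nat.Prime 5) := ⟨by norm_num⟩

def qf (n : ℕ) : QA := ∏ i ∈ Finset.range n, (1 - X ^ (i+1))

lemma qf_succ (n : ℕ) : qf (n+1) = qf n * (1 - X^(n+1)) := by
  simp [qf, Finset.prod_range_succ]

lemma qf_const (n : ℕ) : constantCoeff (qf n) = 1 := by
  simp [qf, map_prod]

lemma qf_inv (n : ℕ) : qf n * (qf n)⁻¹ = 1 :=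
  PowerSeries.mul_inv_cancel _ (by rw [qf_const]; exact one_ne_zero)

/-- Gaussian binomial -/
def qb (N k : ℕ) : QA := if k ≤ N then qf N * (qf k)⁻¹ * (qf (N-k))⁻¹ else 0

lemma qb_add (a b : ℕ) : qb (a+b) a = qf (a+b) * (qf a)⁻¹ * (qf b)⁻¹ := by
  simp [qb]

lemma qb_zero (N : ℕ) : qb N 0 = 1 := by
  have h := qf_inv N
  have h0 := qf_inv 0
  have : qf 0 = 1 := by simp [qf]
  rw [this, one_mul] at h0
  simp [qb, this, h0, h]

lemma qb_self (N : ℕ) : qb N N = 1 := by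
  have h := qf_inv N
  have h0 := qf_inv 0
  have : qf 0 = 1 := by simp [qf]
  rw [this, one_mul] at h0
  simp [qb, this, h0, h]

lemma qb_gt {N k : ℕ} (h : N < k) : qb N k = 0 := by
  simp [qb, h]

lemma qb_pascal (a b : ℕ) :
    qb (a+b+1+1) (a+1) = qb (a+b+1) (a+1) + X^(b+1) * qb (a+b+1) a := by
  have e1 : qb (a+b+1+1) (a+1) = qf (a+b+1+1) * (qf (a+1))⁻¹ * (qf (b+1))⁻¹ := by
    rw [show a+b+1+1 = (a+1)+(b+1) by ring, ← qb_add]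
  have e2 : qb (a+b+1) (a+1) = qf (a+b+1) * (qf (a+1))⁻¹ * (qf b)⁻¹ := by
    rw [show a+b+1 = a+1+b by ring, ← qb_add]
  have e3 : qb (a+b+1) a = qf (a+b+1) * (qf a)⁻¹ * (qf (b+1))⁻¹ := by
    rw [show a+b+1 = a+(b+1) by ring, ← qb_add]
  have ia : (qf a)⁻¹ = (1 - X^(a+1)) * (qf (a+1))⁻¹ := by
    have h1 := qf_inv a
    have h2 := qf_inv (a+1)
    rw [qf_succ] at h2 ⊢
    linear_combination (qf a)⁻¹ * (-h2) + (1 - X^(a+1)) * (qf a * (1 - X^(a+1)))⁻¹ * h1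
  have ib : (qf b)⁻¹ = (1 - X^(b+1)) * (qf (b+1))⁻¹ := by
    have h1 := qf_inv b
    have h2 := qf_inv (b+1)
    rw [qf_succ] at h2 ⊢
    linear_combination (qf b)⁻¹ * (-h2) + (1 - X^(b+1)) * (qf b * (1 - X^(b+1)))⁻¹ * h1
  rw [e1, e2, e3, ia, ib, qf_succ (a+b+1)]
  ring

open Polynomial in
lemma qbinom (x y : Polynomial QA) (N : ℕ) :
    ∏ i ∈ Finset.range N, (y + Polynomial.C ((PowerSeries.X : QA)^i) * x) =
    ∑ k ∈ Finset.range (N+1), Polynomial.C (PowerSeries.X^(k.choose 2) * qb N k) * x^k * y^(N-k) := by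
  induction N with
  | zero => simp [qb_zero]
  | succ N ih =>
    rw [Finset.prod_range_succ, ih, mul_add, Finset.sum_mul, Finset.sum_mul]
    rw [Finset.sum_range_succ' _ (N+1)]
    conv_lhs => rw [Finset.sum_range_succ', Finset.sum_range_succ (fun i => Polynomial.C (PowerSeries.X ^ Nat.choose i 2 * qb N i) * x ^ i * y ^ (N - i) * (Polynomial.C (PowerSeries.X ^ N) * x))]
    rw [Finset.sum_range_succ]
    have : ∀ k ∈ Finset.range N, Polynomial.C (PowerSeries.X ^ Nat.choose (k+1) 2 * qb (N+1) (k+1)) * x ^ (k+1) * y ^ (N + 1 - (k+1)) = Polynomial.C (PowerSeries.X ^ Nat.choose (k+1) 2 * qb N (k+1)) * x ^ (k+1) * y ^ (N - (k+1)) * y + Polynomial.C (PowerSeries.X ^ Nat.choose k 2 * qb N k) * x ^ k * y ^ (N - k) * (Polynomial.C (PowerSeries.X ^ N) * x) := by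
      intro k hk
      obtain ⟨b, rfl⟩ : ∃ b, N = k + b + 1 := ⟨N - k - 1, by have := Finset.mem_range.1 hk; omega⟩
      rw [qb_pascal, show k+b+1+1-(k+1) = b+1 by omega, show k+b+1-(k+1) = b by omega, show k+b+1-k=b+1 by omega, show Nat.choose (k+1) 2 = k + Nat.choose k 2 by rw [Nat.choose_succ_succ' k 1]; simp]
      simp only [map_mul, map_add, map_pow]
      ring
    rw [Finset.sum_congr rfl this, Finset.sum_add_distrib]
    simp only [qb_self, qb_zero, Nat.sub_self, Nat.sub_zero]
    rw [show Nat.choose (N+1) 2 = N + Nat.choose N 2 by rw [Nat.choose_succ_succ' N 1]; simp]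
    simp only [map_mul, map_add, map_pow]
    simp
    ring

lemma qf_cong {m a : ℕ} (h : m ≤ a) : (X : QA)^(m+1) ∣ qf a - qf m := by
  induction a, h using Nat.le_induction with
  | base => simp
  | succ a ha ih =>
    rw [qf_succ, show qf a * (1 - X^(a+1)) - qf m = (qf a - qf m) - X^(a+1) * qf a by ring]
    exact dvd_sub ih (Dvd.dvd.mul_right (pow_dvd_pow _ (by omega)) _)

lemma qb_cong {m a b : ℕ} (ha : m ≤ a) (hb : m ≤ b) :
    (X : QA)^(m+1) ∣ qb (a+b) a - (qf m)⁻¹ := by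
  rw [qb_add]
  obtain ⟨u, hu⟩ := qf_cong ha
  obtain ⟨v, hv⟩ := qf_cong hb
  obtain ⟨w, hw⟩ := qf_cong (show m ≤ a + b by omega)
  have ia := qf_inv a
  have ib := qf_inv b
  have im := qf_inv m
  have key : qf (a+b) * (qf a)⁻¹ * (qf b)⁻¹ - (qf m)⁻¹ =
      (qf m)⁻¹ * (qf a)⁻¹ * (qf b)⁻¹ * (qf m * qf (a+b) - qf a * qf b) := by
    generalize (qf m)⁻¹ = m' at *
    generalize (qf a)⁻¹ = a' at *
    generalize (qf b)⁻¹ = b' at *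
    linear_combination (-qf (a+b) * a' * b') * im + m' * ia * b' * qf b + m' * ib
  rw [key]
  apply Dvd.dvd.mul_left
  rw [sub_eq_iff_eq_add] at hu hv hw
  rw [hu, hv, hw]
  exact ⟨qf m * w - u * qf m - v * qf m - X^(m+1) * u * v, by ring⟩

lemma qb_qf_cong {m a b n : ℕ} (ha : m ≤ a) (hb : m ≤ b) (hn : m ≤ n) :
    (X : QA)^(m+1) ∣ qb (a+b) a * qf n - 1 := by
  have h1 := qb_cong ha hb
  have h2 := qf_cong hn
  have im := qf_inv m
  rw [show qb (a+b) a * qf n - 1 = (qb (a+b) a - (qf m)⁻¹) * qf n + (qf m)⁻¹ * (qf n - qf m) by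
    linear_combination im]
  exact dvd_add (h1.mul_right _) (h2.mul_left _)

lemma qf_reflect (n : ℕ) : ∏ i ∈ Finset.range n, ((X : QA)^i - X^n) = X^(n.choose 2) * qf n := by
  have : ∀ i ∈ Finset.range n, ((X : QA)^i - X^n) = X^i * (1 - X^(n-1-i+1)) := by
    intro i hi
    have := Finset.mem_range.1 hi
    rw [mul_sub, ← pow_add, show i + (n-1-i+1) = n by omega, mul_one]
  rw [Finset.prod_congr rfl this, Finset.prod_mul_distrib, Finset.prod_pow_eq_pow_sum,
    Finset.prod_range_reflect (fun i => (1 - (X : QA)^(i+1))) n, Finset.sum_range_id, Nat.choose_two_right]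
  rfl

lemma qf_second (n : ℕ) : ∏ i ∈ Finset.range n, ((X : QA)^(n+1+i) - X^n) = (-1)^n * X^(n*n) * qf n := by
  have : ∀ i ∈ Finset.range n, ((X : QA)^(n+1+i) - X^n) = ((-1) * X^n) * (1 - X^(i+1)) := by
    intro i hi
    ring
  rw [Finset.prod_congr rfl this, Finset.prod_mul_distrib, Finset.prod_const, Finset.card_range, mul_pow, ← pow_mul]
  rfl

lemma jac1 (n : ℕ) : (X : QA)^(n + n.choose 2 + n*n) * qf n ^ 2 =
    ∑ k ∈ Finset.range (2*n+2), ((-1)^(n+1) * (-1)^(2*n+1-k) * ((2*n+1-k : ℕ) : QA)) *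
      (X^(k.choose 2 + n*(2*n+1-k)) * qb (2*n+1) k) := by
  have h := qbinom 1 (-(Polynomial.C ((X:QA)^n) * Polynomial.X)) (2*n+1)
  have hl : ∏ i ∈ Finset.range (2*n+1), (-(Polynomial.C ((X:QA)^n) * Polynomial.X) + Polynomial.C ((X : QA)^i) * 1) =
      (1 - Polynomial.X) * (Polynomial.C ((X:QA)^n) * ((∏ i ∈ Finset.range n, (-(Polynomial.C ((X:QA)^n) * Polynomial.X) + Polynomial.C ((X : QA)^i) * 1)) * ∏ i ∈ Finset.range n, (-(Polynomial.C ((X:QA)^n) * Polynomial.X) + Polynomial.C ((X : QA)^(n+1+i)) * 1))) := by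
    rw [show 2*n+1 = (n+1)+n by ring, Finset.prod_range_add, Finset.prod_range_succ]
    ring
  rw [hl] at h
  have h2 := congrArg (fun p => Polynomial.eval 1 (Polynomial.derivative p)) h
  simp only [Polynomial.derivative_mul, Polynomial.derivative_sub, Polynomial.derivative_one, Polynomial.derivative_X, Polynomial.eval_add, Polynomial.eval_mul, Polynomial.eval_sub, Polynomial.eval_one, Polynomial.eval_X, sub_self, zero_mul, add_zero, zero_sub, Polynomial.eval_neg, Polynomial.eval_C, Polynomial.eval_prod, Polynomial.derivative_sum, Polynomial.eval_finsetSum, one_pow, mul_one, Polynomial.derivative_C, Polynomial.derivative_pow, Polynomial.derivative_neg, Polynomial.eval_pow, zero_add, one_mul, Polynomial.eval_zero] at h2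
  simp only [neg_add_eq_sub, qf_reflect, qf_second] at h2
  have h3 : (X : QA)^(n + n.choose 2 + n*n) * qf n ^ 2 = (-1)^(n+1) * (-1 * (X^n * (X^(n.choose 2) * qf n * ((-1)^n * X^(n*n) * qf n)))) := by
    have : ((-1 : QA))^n * (-1)^n = 1 := by rw [← mul_pow]; simp
    rw [pow_succ]
    linear_combination (-(X : QA)^(n + n.choose 2 + n*n) * qf n ^ 2) * this
  rw [h3, h2, Finset.mul_sum]
  refine Finset.sum_congr rfl fun k hk => ?_
  have : k ≤ 2*n+1 := by have := Finset.mem_range.1 hk; omega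
  generalize hd : 2*n+1-k = d
  rcases d with _ | d
  · simp
  · simp only [Nat.add_sub_cancel]
    rw [neg_pow (X^n), ← pow_mul]
    simp
    ring

lemma choose_two_int (x : ℕ) : 2 * ((x.choose 2 : ℕ) : ℤ) = x * (x - 1) := by
  induction x with
  | zero => simp
  | succ x ih => rw [Nat.choose_succ_succ' x 1]; push_cast; simp; linarith

lemma tri_mod (t : ℕ) : (t+1).choose 2 % 5 ≠ 2 := by
  intro h
  have h1 := choose_two_int (t+1)
  have h2 : ((t+1).choose 2 : ℤ) % 5 = 2 := by omega
  generalize ((t+1).choose 2 : ℤ) = c at *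
  push_cast at h1
  have h3 : (2 * c) % 5 = 4 := by omega
  rw [h1] at h3
  have : (t : ℤ) % 5 = 0 ∨ (t : ℤ) % 5 = 1 ∨ (t : ℤ) % 5 = 2 ∨ (t : ℤ) % 5 = 3 ∨ (t : ℤ) % 5 = 4 := by omega
  rcases this with h | h | h | h | h <;> simp [Int.mul_emod, Int.add_emod, h] at h3

lemma t_le (t : ℕ) : t ≤ (t+1).choose 2 := by
  rw [Nat.choose_succ_succ' t 1]; simp

lemma jac2 (n a : ℕ) (ha : a ≤ n) (h5 : a % 5 = 2) : coeff a (qf n ^ 3) = 0 := by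
  have h := congrArg (fun f => coeff (a + (n + n.choose 2 + n*n)) (f * qf n)) (jac1 n)
  rw [show (X : QA)^(n + n.choose 2 + n*n) * qf n ^ 2 * qf n = X^(n + n.choose 2 + n*n) * qf n ^ 3 by ring,
    coeff_X_pow_mul] at h
  rw [h, Finset.sum_mul, map_sum]
  refine Finset.sum_eq_zero fun k hk => ?_
  have hk' : k ≤ 2*n+1 := by have := Finset.mem_range.1 hk; omega
  obtain ⟨c, hc⟩ : ∃ c : ZMod 5, ((-1)^(n+1) * (-1)^(2*n+1-k) * ((2*n+1-k : ℕ) : QA)) = C c :=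
    ⟨(-1)^(n+1) * (-1)^(2*n+1-k) * ((2*n+1-k : ℕ) : ZMod 5), by simp⟩
  rw [hc, mul_assoc, coeff_C_mul, mul_assoc, coeff_X_pow_mul']
  split_ifs with he
  swap
  · simp
  obtain ⟨t, ht, he', hm1, hm2⟩ : ∃ t, t ≤ n ∧ k.choose 2 + n*(2*n+1-k) = n + n.choose 2 + n*n + (t+1).choose 2
      ∧ n - t ≤ k ∧ n - t ≤ 2*n+1-k := by
    rcases le_or_gt k n with hkn | hkn
    · obtain ⟨t, rfl⟩ := Nat.exists_eq_add_of_le hkn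
      refine ⟨t, by omega, ?_, by omega, by omega⟩
      have h1 := choose_two_int k
      have h2 := choose_two_int (k+t)
      have h3 := choose_two_int (t+1)
      rw [show 2*(k+t)+1-k = k+2*t+1 by omega]
      push_cast at h1 h2 h3
      zify
      linarith
    · obtain ⟨t, rfl⟩ := Nat.exists_eq_add_of_le (show n+1 ≤ k from hkn)
      have ht : t ≤ n := by omega
      refine ⟨t, by omega, ?_, by omega, by omega⟩
      obtain ⟨d, rfl⟩ := Nat.exists_eq_add_of_le ht
      have h1 := choose_two_int (t+d+1+t)
      have h2 := choose_two_int (t+d)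
      have h3 := choose_two_int (t+1)
      rw [show 2*(t+d)+1-(t+d+1+t) = d by omega]
      push_cast at h1 h2 h3
      zify
      linarith
  have hb := qb_qf_cong (m := n-t) (a := k) (b := 2*n+1-k) (n := n) hm1 hm2 (by omega)
  rw [show k + (2*n+1-k) = 2*n+1 by omega, X_pow_dvd_iff] at hb
  have htt := t_le t
  have htm := tri_mod t
  have := hb (a + (n + n.choose 2 + n*n) - (k.choose 2 + n*(2*n+1-k))) (by omega)
  rw [map_sub, sub_eq_zero] at this
  rw [this, coeff_one, if_neg, mul_zero]
  intro h0
  apply htm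
  rw [← h5]
  congr 1
  omega

lemma coeff_pow5 (f : QA) (j : ℕ) (hj : ¬ 5 ∣ j) : coeff j (f^5) = 0 := by
  have h := MvPowerSeries.map_frobenius_expand (σ := Unit) (R := ZMod 5) 5 (by norm_num) (f := f)
  have h' : PowerSeries.map (frobenius (ZMod 5) 5) (PowerSeries.expand 5 (by norm_num) f) = f ^ 5 := h
  rw [← h', coeff_map, PowerSeries.coeff_expand_of_not_dvd]
  · simp
  · exact hj

lemma main_cong {N a b c d : ℕ} (h5 : N % 5 = 2) (ha : N ≤ a) (hb : N ≤ b) (hc : N ≤ c) (hd : N ≤ d) :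
    coeff N (qb (a+b) a * qb (c+d) c) = 0 := by
  have h1 := qb_cong ha hb
  have h2 := qb_cong hc hd
  have h3 : (X : QA)^(N+1) ∣ qb (a+b) a * qb (c+d) c - (qf N)⁻¹ * (qf N)⁻¹ := by
    rw [show qb (a+b) a * qb (c+d) c - (qf N)⁻¹ * (qf N)⁻¹ = (qb (a+b) a - (qf N)⁻¹) * qb (c+d) c + (qf N)⁻¹ * (qb (c+d) c - (qf N)⁻¹) by ring]
    exact dvd_add (h1.mul_right _) (h2.mul_left _)
  rw [X_pow_dvd_iff] at h3
  have h4 := h3 N (by omega)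
  rw [map_sub, sub_eq_zero] at h4
  have im := qf_inv N
  have h6 : (qf N)⁻¹ * (qf N)⁻¹ = qf N ^ 3 * (qf N)⁻¹ ^ 5 := by
    calc (qf N)⁻¹ * (qf N)⁻¹ = (qf N * (qf N)⁻¹)^3 * ((qf N)⁻¹ * (qf N)⁻¹) := by rw [im]; ring
      _ = _ := by ring
  rw [h4, h6, coeff_mul]
  refine Finset.sum_eq_zero fun p hp => ?_
  have hp' := Finset.HasAntidiagonal.mem_antidiagonal.1 hp
  by_cases hj : 5 ∣ p.2
  · rw [jac2 N p.1 (by omega) (by omega), zero_mul]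
  · rw [coeff_pow5 _ _ hj, mul_zero]

lemma sub_gen (M k : ℕ) (hk : k ≤ M) : ∑ A ∈ Finset.powersetCard k (Finset.range M), (X : QA)^(∑ i ∈ A, i) =
    X^(k.choose 2) * qb M k := by
  have h := qbinom Polynomial.X 1 M
  rw [Finset.prod_one_add] at h
  have h2 := congrArg (fun p => Polynomial.coeff p k) h
  simp only [Finset.prod_mul_distrib, Finset.prod_const, ← map_prod, one_pow, mul_one,
    Polynomial.finsetSum_coeff, Polynomial.coeff_C_mul, Polynomial.coeff_X_pow, mul_ite, mul_zero] at h2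
  rw [Finset.sum_ite_eq, if_pos (Finset.mem_range.2 (by omega))] at h2
  rw [← h2, ← Finset.sum_filter]
  refine Finset.sum_congr ?_ (fun A _ => (Finset.prod_pow_eq_pow_sum _ _ _).symm)
  ext A
  simp [Finset.mem_powersetCard, eq_comm]

lemma cnt (M k l s : ℕ) (hk : k ≤ M) (hl : l ≤ M) :
    ((((Finset.powersetCard k (Finset.range M)) ×ˢ (Finset.powersetCard l (Finset.range M))).filter
      (fun p => ∑ i ∈ p.1, i + ∑ i ∈ p.2, i = s)).card : ZMod 5) =
    coeff s (X^(k.choose 2 + l.choose 2) * (qb M k * qb M l)) := by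
  rw [show (X : QA)^(k.choose 2 + l.choose 2) * (qb M k * qb M l) = (X^(k.choose 2) * qb M k) * (X^(l.choose 2) * qb M l) by ring,
    ← sub_gen M k hk, ← sub_gen M l hl, Finset.sum_mul_sum, ← Finset.sum_product', map_sum]
  simp only [← pow_add, coeff_X_pow]
  rw [Finset.sum_boole]
  congr 2
  ext p
  simp [eq_comm]

end

/-- staircase shift -/
def shiftL : List ℕ → List ℕ
  | [] => []
  | a :: l => (a + l.length) :: shiftL l

/-- inverse of the staircase shift -/
def unshiftL : List ℕ → List ℕ
  | [] => []
  | a :: l => (a - l.length) :: unshiftL l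

lemma shiftL_length (l : List ℕ) : (shiftL l).length = l.length := by
  induction l with
  | nil => rfl
  | cons a l ih => simp [shiftL, ih]

lemma unshiftL_length (l : List ℕ) : (unshiftL l).length = l.length := by
  induction l with
  | nil => rfl
  | cons a l ih => simp [unshiftL, ih]

lemma unshift_shift (l : List ℕ) : unshiftL (shiftL l) = l := by
  induction l with
  | nil => rfl
  | cons a l ih => simp [unshiftL, shiftL, ih, shiftL_length]

lemma mem_shift_lt (l : List ℕ) : ∀ a, l.Pairwise (· ≥ ·) → (∀ y ∈ l, y ≤ a) → ∀ x ∈ shiftL l, x < a + l.length := by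
  induction l with
  | nil => intro a _ _ x hx; simp [shiftL] at hx
  | cons b l ih =>
    intro a hp h x hx
    rw [List.pairwise_cons] at hp
    simp only [shiftL, List.mem_cons] at hx
    have hb := h b (by simp)
    simp only [List.length_cons]
    rcases hx with rfl | hx
    · omega
    · have := ih a hp.2 (fun y hy => h y (by simp [hy])) x hx
      omega

lemma shift_pairwise (l : List ℕ) (h : l.Pairwise (· ≥ ·)) : (shiftL l).Pairwise (· > ·) := by
  induction l with
  | nil => simp [shiftL]
  | cons a l ih =>
    rw [List.pairwise_cons] at h
    simp only [shiftL, List.pairwise_cons]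
    exact ⟨fun x hx => mem_shift_lt l a h.2 h.1 x hx, ih h.2⟩

lemma unshift_aux (l : List ℕ) : ∀ a, l.Pairwise (· > ·) → (∀ y ∈ l, y < a) →
    l.length ≤ a ∧ ∀ x ∈ unshiftL l, x ≤ a - l.length := by
  induction l with
  | nil => intro a _ _; simp [unshiftL]
  | cons b l ih =>
    intro a hp h
    rw [List.pairwise_cons] at hp
    have hb := h b (by simp)
    obtain ⟨h1, h2⟩ := ih b hp.2 hp.1
    simp only [List.length_cons, unshiftL, List.mem_cons]
    refine ⟨by omega, ?_⟩
    rintro x (rfl | hx)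
    · omega
    · have := h2 x hx
      omega

lemma unshift_pairwise (l : List ℕ) (h : l.Pairwise (· > ·)) : (unshiftL l).Pairwise (· ≥ ·) := by
  induction l with
  | nil => simp [unshiftL]
  | cons a l ih =>
    rw [List.pairwise_cons] at h
    simp only [unshiftL, List.pairwise_cons]
    exact ⟨fun x hx => (unshift_aux l a h.2 h.1).2 x hx, ih h.2⟩

lemma shift_unshift (l : List ℕ) (h : l.Pairwise (· > ·)) : shiftL (unshiftL l) = l := by
  induction l with
  | nil => rfl
  | cons a l ih =>
    rw [List.pairwise_cons] at h
    have := (unshift_aux l a h.2 h.1).1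
    simp [unshiftL, shiftL, ih h.2, unshiftL_length, this]

lemma shift_sum (l : List ℕ) : (shiftL l).sum = l.sum + l.length.choose 2 := by
  induction l with
  | nil => simp [shiftL]
  | cons a l ih =>
    simp only [shiftL, List.sum_cons, ih, List.length_cons]
    rw [Nat.choose_succ_succ' l.length 1]
    simp
    ring

lemma bg_nil : bgRank [] = 0 := by simp [bgRank]

lemma bg_cons (a : ℕ) (l : List ℕ) : bgRank (a :: l) = (a : ℤ) % 2 - bgRank l := by
  simp only [bgRank, List.length_cons]
  rw [Finset.sum_range_succ', sub_eq_add_neg, add_comm, ← Finset.sum_neg_distrib]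
  simp [pow_succ]

lemma bg_replicate (m : ℕ) : bgRank (List.replicate m 0) = 0 := by
  induction m with
  | zero => simp [bg_nil]
  | succ m ih => simp [List.replicate_succ, bg_cons, ih]

lemma bg_pad (l : List ℕ) (m : ℕ) : bgRank (l ++ List.replicate m 0) = bgRank l := by
  induction l with
  | nil => simp [bg_replicate, bg_nil]
  | cons a l ih => simp [bg_cons, ih]

lemma shift_odd (l : List ℕ) :
    (l.length % 2 = 0 → 2 * ((((shiftL l).map (· % 2)).sum : ℕ) : ℤ) = l.length - 2 * bgRank l) ∧
    (l.length % 2 = 1 → 2 * ((((shiftL l).map (· % 2)).sum : ℕ) : ℤ) = l.length - 1 + 2 * bgRank l) := by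
  induction l with
  | nil => simp [shiftL, bg_nil]
  | cons a l ih =>
    simp only [shiftL, List.map_cons, List.sum_cons, List.length_cons, bg_cons]
    generalize ((shiftL l).map (· % 2)).sum = s at *
    generalize l.length = m at *
    generalize bgRank l = b at *
    obtain ⟨i1, i2⟩ := ih
    constructor
    · intro h
      have := i2 (by omega)
      push_cast
      omega
    · intro h
      have := i1 (by omega)
      push_cast
      omega

lemma len_le_sum (l : List ℕ) (h : ∀ x ∈ l, 0 < x) : l.length ≤ l.sum := by
  induction l with
  | nil => simp
  | cons a l ih =>
    have h1 := h a (by simp)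
    have h2 := ih (fun x hx => h x (by simp [hx]))
    simp only [List.length_cons, List.sum_cons]
    omega

lemma filter_pad (l : List ℕ) (h : l.Pairwise (· ≥ ·)) :
    (l.filter (fun x => decide (0 < x))) ++ List.replicate (l.length - (l.filter (fun x => decide (0 < x))).length) 0 = l := by
  induction l with
  | nil => simp
  | cons a l ih =>
    rw [List.pairwise_cons] at h
    by_cases ha : 0 < a
    · have := ih h.2
      rw [List.filter_cons_of_pos (by simpa using ha)]
      simp only [List.length_cons, List.cons_append, Nat.add_sub_add_right, this]
    · have ha0 : a = 0 := by omega
      have hl : ∀ x ∈ l, x = 0 := fun x hx => by have := h.1 x hx; omega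
      have : l = List.replicate l.length 0 := List.eq_replicate_iff.2 ⟨rfl, hl⟩
      have hf : (a :: l).filter (fun x => decide (0 < x)) = [] := by
        rw [List.filter_eq_nil_iff]
        intro x hx
        simp only [List.mem_cons] at hx
        rcases hx with rfl | hx
        · simpa using ha
        · simp [hl x hx]
      rw [hf, ha0]
      simp only [List.nil_append, List.length_cons, List.length_nil, Nat.sub_zero, List.replicate_succ]
      rw [← this]

/-- padding by zeros -/
def equivPad (n m : ℕ) (j : ℤ) (hm : n ≤ m) :
    {l : List ℕ // IsPartition l ∧ l.sum = n ∧ bgRank l = j} ≃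
    {l : List ℕ // l.Pairwise (· ≥ ·) ∧ l.length = m ∧ l.sum = n ∧ bgRank l = j} where
  toFun l := ⟨l.1 ++ List.replicate (m - l.1.length) 0, by
    obtain ⟨l, ⟨h1, h2⟩, h3, h4⟩ := l
    have := len_le_sum l h2
    refine ⟨?_, by simp; omega, by simpa using h3, by rw [bg_pad, h4]⟩
    rw [List.pairwise_append]
    refine ⟨h1, by simp [List.pairwise_replicate], ?_⟩
    intro a _ b hb
    rw [List.eq_of_mem_replicate hb]
    exact Nat.zero_le _⟩
  invFun l := ⟨l.1.filter (fun x => decide (0 < x)), by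
    obtain ⟨l, h1, h2, h3, h4⟩ := l
    have hf := filter_pad l h1
    refine ⟨⟨h1.filter _, by simp⟩, ?_, ?_⟩
    · refine Eq.trans ?_ h3; conv_rhs => rw [← hf]
      simp
    · refine Eq.trans ?_ h4; conv_rhs => rw [← hf, bg_pad]⟩
  left_inv l := by
    obtain ⟨l, ⟨h1, h2⟩, h3, h4⟩ := l
    ext1
    simp only [List.filter_append]
    rw [List.filter_eq_self.2 (by simpa using h2), List.filter_replicate]
    simp
  right_inv l := by
    obtain ⟨l, h1, h2, h3, h4⟩ := l
    ext1
    have := filter_pad l h1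
    rw [h2] at this
    exact this

/-- staircase shift as an equivalence -/
def equivShift (n h : ℕ) (j : ℤ) :
    {l : List ℕ // l.Pairwise (· ≥ ·) ∧ l.length = 2*h ∧ l.sum = n ∧ bgRank l = j} ≃
    {l : List ℕ // l.Pairwise (· > ·) ∧ l.length = 2*h ∧ l.sum = n + (2*h).choose 2 ∧
      (((l.map (· % 2)).sum : ℕ) : ℤ) = h - j} where
  toFun l := ⟨shiftL l.1, by
    obtain ⟨l, h1, h2, h3, h4⟩ := l
    refine ⟨shift_pairwise l h1, by rw [shiftL_length, h2], (shift_sum l).trans (by rw [h3, h2]), ?_⟩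
    have := (shift_odd l).1 (by omega)
    simp only
    rw [h2, h4] at this
    push_cast at this
    push_cast
    linarith⟩
  invFun l := ⟨unshiftL l.1, by
    obtain ⟨l, h1, h2, h3, h4⟩ := l
    have hl := unshiftL_length l
    have e := shift_unshift l h1
    have hs := shift_sum (unshiftL l)
    have := (shift_odd (unshiftL l)).1 (by omega)
    rw [e, hl, h2] at this hs
    rw [h4] at this
    refine ⟨unshift_pairwise l h1, by rw [hl, h2], by simp only; omega, ?_⟩
    push_cast at this
    simp only
    linarith⟩
  left_inv l := by
    ext1
    exact unshift_shift l.1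
  right_inv l := by
    ext1
    exact shift_unshift l.1 l.2.1

/-- strictly decreasing lists are finsets -/
def equivFin (n h : ℕ) (j : ℤ) :
    {l : List ℕ // l.Pairwise (· > ·) ∧ l.length = 2*h ∧ l.sum = n + (2*h).choose 2 ∧
      (((l.map (· % 2)).sum : ℕ) : ℤ) = h - j} ≃
    {S : Finset ℕ // S.card = 2*h ∧ ∑ i ∈ S, i = n + (2*h).choose 2 ∧
      ((∑ i ∈ S, i % 2 : ℕ) : ℤ) = h - j} where
  toFun l := ⟨l.1.toFinset, by
    obtain ⟨l, h1, h2, h3, h4⟩ := l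
    have nd : l.Nodup := h1.imp (fun h => ne_of_gt h)
    refine ⟨by rw [List.toFinset_card_of_nodup nd, h2], ?_, ?_⟩
    · rw [List.sum_toFinset _ nd, ← h3]; simp
    · rw [List.sum_toFinset _ nd, ← h4]⟩
  invFun S := ⟨S.1.sort (· ≥ ·), by
    obtain ⟨S, h1, h2, h3⟩ := S
    have nd := S.sort_nodup (· ≥ ·)
    have e := S.sort_toFinset (· ≥ ·)
    refine ⟨(S.sortedGT_sort).pairwise, by simp [h1], ?_, ?_⟩
    · refine Eq.trans ?_ h2; conv_rhs => rw [← e, List.sum_toFinset _ nd]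
      simp
    · refine Eq.trans ?_ h3; conv_rhs => rw [← e, List.sum_toFinset _ nd]⟩
  left_inv l := by
    obtain ⟨l, h1, h2, h3, h4⟩ := l
    ext1
    have nd : l.Nodup := h1.imp (fun h => ne_of_gt h)
    exact (List.toFinset_sort (· ≥ ·) nd).2 (h1.imp (fun h => le_of_lt h))
  right_inv S := by
    ext1
    exact S.1.sort_toFinset (· ≥ ·)

/-- splitting by parity -/
def equivPar (n h k l : ℕ) (j : ℤ) (hk : (k : ℤ) = h + j) (hl : (l : ℤ) = h - j) :
    {p : Finset ℕ × Finset ℕ // p.1.card = k ∧ p.2.card = l ∧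
      2 * (∑ i ∈ p.1, i + ∑ i ∈ p.2, i) + l = n + (2*h).choose 2} ≃
    {S : Finset ℕ // S.card = 2*h ∧ ∑ i ∈ S, i = n + (2*h).choose 2 ∧
      ((∑ i ∈ S, i % 2 : ℕ) : ℤ) = h - j} :=
  Equiv.subtypeEquiv (Finset.sumEquiv.symm.toEquiv.trans (Equiv.finsetCongr Equiv.natSumNatEquivNat)) (by
    rintro ⟨A, B⟩
    have e1 : ∀ f : ℕ → ℕ, ∑ i ∈ (A.disjSum B).map Equiv.natSumNatEquivNat.toEmbedding, f i = ∑ i ∈ A, f (2*i) + ∑ i ∈ B, f (2*i+1) := by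
      intro f
      rw [Finset.sum_map, Finset.sum_disjSum]
      simp
    have e2 := e1 id
    have e3 := e1 (· % 2)
    simp only [id, Finset.sum_add_distrib, Finset.sum_const, smul_eq_mul, mul_one] at e2
    rw [← Finset.mul_sum, ← Finset.mul_sum] at e2
    have e4 : ∀ x, (2*x+1) % 2 = 1 := by intro x; omega
    simp only [Nat.mul_mod_right, e4, Finset.sum_const, smul_eq_mul, mul_one, mul_zero, zero_add] at e3
    simp only [Equiv.trans_apply, Equiv.finsetCongr_apply]
    change _ ↔ (Finset.map Equiv.natSumNatEquivNat.toEmbedding (A.disjSum B)).card = _ ∧ ∑ i ∈ (Finset.map Equiv.natSumNatEquivNat.toEmbedding (A.disjSum B)), i = _ ∧ ((∑ i ∈ (Finset.map Equiv.natSumNatEquivNat.toEmbedding (A.disjSum B)), i % 2 : ℕ) : ℤ) = _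
    rw [e2, e3, Finset.card_map, Finset.card_disjSum]
    omega)

lemma pj_eq (n h k l : ℕ) (j : ℤ) (hn : n ≤ 2*h) (hk : (k : ℤ) = h + j) (hl : (l : ℤ) = h - j) :
    pj j n = Nat.card {p : Finset ℕ × Finset ℕ // p.1.card = k ∧ p.2.card = l ∧
      2 * (∑ i ∈ p.1, i + ∑ i ∈ p.2, i) + l = n + (2*h).choose 2} :=
  Nat.card_congr ((((equivPad n (2*h) j hn).trans (equivShift n h j)).trans (equivFin n h j)).trans
    (equivPar n h k l j hk hl).symm)

lemma pj_cong (N h k l : ℕ) (j : ℤ) (hN : N ≤ 2*h) (hk : (k : ℤ) = h + j) (hl : (l : ℤ) = h - j)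
    (hkN : N ≤ k) (hlN : N ≤ l) (h5 : N % 5 = 0) (hj : j % 5 = 1 ∨ j % 5 = 2) : 5 ∣ pj j N := by
  rw [pj_eq N h k l j hN hk hl]
  by_cases hs : ∃ s, 2 * s + l = N + (2*h).choose 2
  swap
  · have : IsEmpty {p : Finset ℕ × Finset ℕ // p.1.card = k ∧ p.2.card = l ∧
      2 * (∑ i ∈ p.1, i + ∑ i ∈ p.2, i) + l = N + (2*h).choose 2} :=
      ⟨fun p => hs ⟨_, p.2.2.2⟩⟩
    simp
  obtain ⟨s, hs⟩ := hs
  set M := s + 1 + k + l + N with hM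
  have hc : Nat.card {p : Finset ℕ × Finset ℕ // p.1.card = k ∧ p.2.card = l ∧
      2 * (∑ i ∈ p.1, i + ∑ i ∈ p.2, i) + l = N + (2*h).choose 2} =
      (((Finset.powersetCard k (Finset.range M)) ×ˢ (Finset.powersetCard l (Finset.range M))).filter
      (fun p => ∑ i ∈ p.1, i + ∑ i ∈ p.2, i = s)).card := by
    rw [← Nat.card_eq_finsetCard]
    refine Nat.card_congr (Equiv.subtypeEquivRight ?_)
    rintro ⟨A, B⟩
    simp only [Finset.mem_filter, Finset.mem_product, Finset.mem_powersetCard]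
    constructor
    · rintro ⟨h1, h2, h3⟩
      have h4 : ∑ i ∈ A, i + ∑ i ∈ B, i = s := by omega
      refine ⟨⟨⟨fun x hx => ?_, h1⟩, ⟨fun x hx => ?_, h2⟩⟩, h4⟩
      · have := Finset.single_le_sum (f := fun i : ℕ => i) (fun i _ => Nat.zero_le i) hx
        rw [Finset.mem_range]
        omega
      · have := Finset.single_le_sum (f := fun i : ℕ => i) (fun i _ => Nat.zero_le i) hx
        rw [Finset.mem_range]
        omega
    · rintro ⟨⟨⟨_, h1⟩, ⟨_, h2⟩⟩, h4⟩
      exact ⟨h1, h2, by omega⟩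
  rw [hc, ← ZMod.natCast_eq_zero_iff, cnt M k l s (by omega) (by omega), PowerSeries.coeff_X_pow_mul']
  split_ifs with hle
  swap
  · rfl
  obtain ⟨t, rfl⟩ := Nat.exists_eq_add_of_le hle
  have c1 := choose_two_int k
  have c2 := choose_two_int l
  have c3 := choose_two_int (2*h)
  have ht : 2 * (t : ℤ) = N + j - 2 * j * j := by
    zify at hs
    push_cast at c1 c2 c3
    rw [hk] at c1
    rw [hl] at c2 hs
    nlinarith
  have htN : t ≤ N := by
    have : j ≤ 2 * j * j := by nlinarith [mul_self_nonneg (j), Int.le_self_sq j]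
    have : 2 * (t : ℤ) ≤ N := by linarith
    omega
  have ht5 : t % 5 = 2 := by
    have h1 : (2 * j * j) % 5 = (if j % 5 = 1 then 2 else 3) := by
      rcases hj with h | h <;> simp [Int.mul_emod, h]
    generalize 2 * j * j = w at *
    split_ifs at h1 <;> omega
  rw [Nat.add_sub_cancel_left]
  have := main_cong (N := t) (a := k) (b := M - k) (c := l) (d := M - l) ht5 (by omega) (by omega) (by omega) (by omega)
  rwa [show k + (M - k) = M by omega, show l + (M - l) = M by omega] at this

theorem pj_five_mul_cong (n : ℕ) (j : ℤ) (hj : j % 5 = 1 ∨ j % 5 = 2) :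
    (5 : ℕ) ∣ pj j (5 * n) := by
  have h1 : ((5*n + j.natAbs + j).toNat : ℤ) = ((5*n + j.natAbs : ℕ) : ℤ) + j := by
    rw [Int.toNat_of_nonneg (by omega)]; push_cast; ring
  have h2 : ((5*n + j.natAbs - j).toNat : ℤ) = ((5*n + j.natAbs : ℕ) : ℤ) - j := by
    rw [Int.toNat_of_nonneg (by omega)]; push_cast; ring
  exact pj_cong (5*n) (5*n + j.natAbs) _ _ j (by omega) h1 h2 (by omega) (by omega) (by omega) hj
end

section
/- For every natural number n and every integer j with j ≡ 0 or 3 (mod 5), the number p_j(5n+3) of partitions of 5n+3 with BG-rank j is divisible by 5. -/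
open PowerSeries

instance bg_fact5 : Fact (Nat.Prime 5) := ⟨by norm_num⟩

noncomputable def bgP (n : ℕ) : PowerSeries (ZMod 5) :=
  ∏ i ∈ Finset.range n, (1 - (X : PowerSeries (ZMod 5)) ^ (2 * (i + 1)))

noncomputable def bgI (n : ℕ) : PowerSeries (ZMod 5) := (bgP n)⁻¹

lemma bgP_const (n : ℕ) : constantCoeff (bgP n) = 1 := by
  simp [bgP, map_prod]

lemma bgP_mul_bgI (n : ℕ) : bgP n * bgI n = 1 :=
  PowerSeries.mul_inv_cancel _ (by rw [bgP_const]; exact one_ne_zero)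

lemma bgI_succ (n : ℕ) : (1 - X ^ (2 * (n + 1))) * bgI (n + 1) = bgI n := by
  have h1 := bgP_mul_bgI n
  have h2 := bgP_mul_bgI (n + 1)
  have h3 : bgP (n + 1) = bgP n * (1 - X ^ (2 * (n + 1))) := by
    simp [bgP, Finset.prod_range_succ]
  rw [h3] at h2
  linear_combination (-bgI (n+1) * (1 - X ^ (2 * (n + 1)))) * h1 + bgI n * h2

lemma bgI_zero : bgI 0 = 1 := by
  have := bgP_mul_bgI 0
  simpa [bgP] using this

/-- Gauss' q-binomial theorem, normalised. -/
lemma bg_qbinom_gen {A : Type*} [CommRing A] [IsDomain A] (q : A) (J : ℕ → A)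
    (h0 : J 0 = 1) (hs : ∀ n, (1 - q ^ (n + 1)) * J (n + 1) = J n)
    (hq : ∀ n, 1 - q ^ (n + 1) ≠ 0) (N : ℕ) (u z : A) :
    ∑ p ∈ Finset.HasAntidiagonal.antidiagonal N,
      q ^ (p.1 * (p.1 - 1) / 2) * J p.1 * J p.2 * z ^ p.1 * u ^ p.2
    = J N * ∏ i ∈ Finset.range N, (u + z * q ^ i) := by
  induction N with
  | zero => simp [h0]
  | succ N ih =>
    have e1 : (1 - q ^ (N + 1)) *
        ∑ p ∈ Finset.HasAntidiagonal.antidiagonal (N + 1),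
          q ^ (p.1 * (p.1 - 1) / 2) * J p.1 * J p.2 * z ^ p.1 * u ^ p.2
        = ∑ p ∈ Finset.HasAntidiagonal.antidiagonal (N + 1),
          q ^ (p.1 * (p.1 - 1) / 2) * J p.1 * ((1 - q ^ p.2) * J p.2) * z ^ p.1 * u ^ p.2
        + ∑ p ∈ Finset.HasAntidiagonal.antidiagonal (N + 1),
          q ^ (p.1 * (p.1 - 1) / 2) * q ^ p.2 * ((1 - q ^ p.1) * J p.1)
            * J p.2 * z ^ p.1 * u ^ p.2 := by
      rw [Finset.mul_sum, ← Finset.sum_add_distrib]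
      refine Finset.sum_congr rfl fun p hp => ?_
      rw [Finset.HasAntidiagonal.mem_antidiagonal] at hp
      rw [← hp, pow_add]
      ring
    have e2 : ∑ p ∈ Finset.HasAntidiagonal.antidiagonal (N + 1),
          q ^ (p.1 * (p.1 - 1) / 2) * J p.1 * ((1 - q ^ p.2) * J p.2) * z ^ p.1 * u ^ p.2
        = u * ∑ p ∈ Finset.HasAntidiagonal.antidiagonal N,
          q ^ (p.1 * (p.1 - 1) / 2) * J p.1 * J p.2 * z ^ p.1 * u ^ p.2 := by
      rw [Finset.Nat.sum_antidiagonal_succ', Finset.mul_sum]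
      simp only [pow_zero, sub_self, zero_mul, mul_zero, zero_add, hs]
      refine Finset.sum_congr rfl fun p hp => ?_
      ring
    have e3 : ∑ p ∈ Finset.HasAntidiagonal.antidiagonal (N + 1),
          q ^ (p.1 * (p.1 - 1) / 2) * q ^ p.2 * ((1 - q ^ p.1) * J p.1)
            * J p.2 * z ^ p.1 * u ^ p.2
        = z * q ^ N * ∑ p ∈ Finset.HasAntidiagonal.antidiagonal N,
          q ^ (p.1 * (p.1 - 1) / 2) * J p.1 * J p.2 * z ^ p.1 * u ^ p.2 := by
      rw [Finset.Nat.sum_antidiagonal_succ, Finset.mul_sum]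
      simp only [pow_zero, sub_self, zero_mul, mul_zero, zero_add, hs, add_tsub_cancel_right]
      refine Finset.sum_congr rfl fun p hp => ?_
      rw [Finset.HasAntidiagonal.mem_antidiagonal] at hp
      have : q ^ ((p.1 + 1) * p.1 / 2) * q ^ p.2 = q ^ N * q ^ (p.1 * (p.1 - 1) / 2) := by
        rw [← pow_add, ← pow_add, ← hp]
        congr 1
        have h1 := Nat.triangle_succ p.1
        simp only [add_tsub_cancel_right] at h1
        omega
      rw [this]
      ring
    apply mul_left_cancel₀ (hq N)
    rw [e1, e2, e3, ih, Finset.prod_range_succ, ← hs N]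
    ring

lemma bg_one_sub_ne (n : ℕ) : 1 - (X : PowerSeries (ZMod 5)) ^ (2 * (n + 1)) ≠ 0 := by
  intro h
  have := congrArg constantCoeff h
  simp at this

lemma bg_qbinom (N : ℕ) (u z : Polynomial (PowerSeries (ZMod 5))) :
    ∑ p ∈ Finset.HasAntidiagonal.antidiagonal N,
      Polynomial.C (X ^ (p.1 * (p.1 - 1)) * bgI p.1 * bgI p.2) * z ^ p.1 * u ^ p.2
    = Polynomial.C (bgI N) *
      ∏ i ∈ Finset.range N, (u + z * Polynomial.C (X ^ (2 * i))) := by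
  have hC : ∀ n, 1 - (Polynomial.C ((X : PowerSeries (ZMod 5)) ^ 2)) ^ n
      = Polynomial.C (1 - X ^ (2 * n)) := by
    intro n
    rw [← Polynomial.C_pow, ← pow_mul, Polynomial.C_sub, Polynomial.C_1]
  have h := bg_qbinom_gen (Polynomial.C ((X : PowerSeries (ZMod 5)) ^ 2))
    (fun n => Polynomial.C (bgI n)) (by simp [bgI_zero])
    (by intro n; rw [hC, ← Polynomial.C_mul, bgI_succ])
    (by intro n; rw [hC, Ne, Polynomial.C_eq_zero]; exact bg_one_sub_ne n) N u z
  simp only [← Polynomial.C_pow, ← pow_mul, ← Polynomial.C_mul] at h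
  rw [← h]
  refine Finset.sum_congr rfl fun p hp => ?_
  rw [Nat.mul_div_cancel' (Nat.even_mul_pred_self p.1).two_dvd]

lemma bg_prod_split (n : ℕ) (f : ℕ → Polynomial (PowerSeries (ZMod 5))) :
    ∏ i ∈ Finset.range (2 * n + 1), f i
      = f n * ((∏ i ∈ Finset.range n, f (n - 1 - i)) * ∏ i ∈ Finset.range n, f (n + 1 + i)) := by
  rw [show 2 * n + 1 = (n + 1) + n by ring, Finset.prod_range_add, Finset.prod_range_succ,
    Finset.prod_range_reflect f n]
  ring

lemma bg_sum_split (n : ℕ) (f : ℕ → PowerSeries (ZMod 5)) :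
    ∑ i ∈ Finset.range (2 * n + 2), f i
      = ∑ r ∈ Finset.range (n + 1), (f (n + 1 + r) + f (n - r)) := by
  rw [show 2 * n + 2 = (n + 1) + (n + 1) by ring, Finset.sum_range_add, Finset.sum_add_distrib,
    ← Finset.sum_range_reflect f (n + 1), add_comm]
  simp

lemma bg_deriv (n : ℕ) :
    ∑ k ∈ Finset.range (2 * n + 2),
      (X ^ (k * (k - 1)) * bgI k * bgI (2 * n + 1 - k)) * ((k : PowerSeries (ZMod 5)) * (-1) ^ (k - 1))
        * (X ^ (2 * n)) ^ (2 * n + 1 - k)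
    = bgI (2 * n + 1) * (X ^ (2 * n) *
      ((∏ i ∈ Finset.range n, (X ^ (2 * n) - X ^ (2 * (n - 1 - i)))) *
        ∏ i ∈ Finset.range n, (X ^ (2 * n) - X ^ (2 * (n + 1 + i))))) := by
  have h := bg_qbinom (2 * n + 1) (Polynomial.C (X ^ (2 * n))) Polynomial.X
  rw [Finset.Nat.sum_antidiagonal_eq_sum_range_succ_mk, bg_prod_split] at h
  have h2 := congrArg (fun p => Polynomial.eval (-1) (Polynomial.derivative p)) h
  simp only [Polynomial.derivative_mul, Polynomial.derivative_sum, Polynomial.derivative_C,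
    Polynomial.derivative_X, Polynomial.derivative_add, ← Polynomial.C_pow,
    Polynomial.derivative_X_pow, Polynomial.eval_add, Polynomial.eval_mul, Polynomial.eval_C,
    Polynomial.eval_finsetSum, Polynomial.eval_X, Polynomial.eval_pow, Polynomial.eval_prod,
    zero_mul, mul_zero, zero_add, add_zero, one_mul,
    neg_one_mul, add_neg_cancel, ← sub_eq_add_neg] at h2
  convert h2 using 1

lemma bg_prod1 (n : ℕ) :
    ∏ i ∈ Finset.range n, ((X : PowerSeries (ZMod 5)) ^ (2 * n) - X ^ (2 * (n - 1 - i)))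
    = (-1) ^ n * bgP n * X ^ (n * (n - 1)) := by
  have h1 : (X : PowerSeries (ZMod 5)) ^ (n * (n - 1))
      = ∏ i ∈ Finset.range n, X ^ (2 * (n - 1 - i)) := by
    rw [Finset.prod_range_reflect (fun i => (X : PowerSeries (ZMod 5)) ^ (2 * i)) n,
      Finset.prod_pow_eq_pow_sum, ← Finset.mul_sum, mul_comm, mul_comm 2, Finset.sum_range_id_mul_two, mul_comm]
  have h2 : (-1 : PowerSeries (ZMod 5)) ^ n = ∏ i ∈ Finset.range n, (-1) := by simp
  rw [h1, h2, bgP, ← Finset.prod_mul_distrib, ← Finset.prod_mul_distrib]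
  refine Finset.prod_congr rfl fun i hi => ?_
  rw [Finset.mem_range] at hi
  obtain ⟨t, rfl⟩ : ∃ t, n = i + 1 + t := ⟨n - i - 1, by omega⟩
  rw [show i + 1 + t - 1 - i = t by omega]
  ring

lemma bg_prod2 (n : ℕ) :
    ∏ i ∈ Finset.range n, ((X : PowerSeries (ZMod 5)) ^ (2 * n) - X ^ (2 * (n + 1 + i)))
    = bgP n * X ^ (2 * n * n) := by
  have h1 : (X : PowerSeries (ZMod 5)) ^ (2 * n * n)
      = ∏ i ∈ Finset.range n, X ^ (2 * n) := by
    simp [pow_mul]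
  rw [h1, bgP, ← Finset.prod_mul_distrib]
  refine Finset.prod_congr rfl fun i hi => ?_
  ring

/-- finite form of Jacobi's identity -/
lemma bg_jacobi (n : ℕ) :
    ∑ r ∈ Finset.range (n + 1),
      (-1) ^ r * (2 * (r : PowerSeries (ZMod 5)) + 1) * X ^ (r * (r + 1)) * bgI (n - r) * bgI (n + 1 + r)
    = bgP n ^ 2 * bgI (2 * n + 1) := by
  have h := bg_deriv n
  rw [bg_prod1, bg_prod2, bg_sum_split] at h
  have hX : (X : PowerSeries (ZMod 5)) ^ (3 * n * n + n) ≠ 0 := pow_ne_zero _ X_ne_zero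
  have hE : (X : PowerSeries (ZMod 5)) ^ (3 * n * n + n)
      = X ^ (2 * n) * X ^ (n * (n - 1)) * X ^ (2 * n * n) := by
    rw [← pow_add, ← pow_add]
    congr 1
    rcases n with _ | n
    · simp
    · simp; ring
  have h1 : ((-1 : PowerSeries (ZMod 5)) ^ n) * (-1) ^ n = 1 := by
    rw [← mul_pow]; simp
  apply mul_left_cancel₀ hX
  have h3 : (X : PowerSeries (ZMod 5)) ^ (3 * n * n + n) * (bgP n ^ 2 * bgI (2 * n + 1))
      = (-1) ^ n * (bgI (2 * n + 1) * (X ^ (2 * n) * ((-1) ^ n * bgP n * X ^ (n * (n - 1)) * (bgP n * X ^ (2 * n * n))))) := by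
    rw [hE]
    linear_combination (-(X ^ (2 * n) * X ^ (n * (n - 1)) * X ^ (2 * n * n)) * (bgP n ^ 2 * bgI (2 * n + 1))) * h1
  rw [h3, ← h, Finset.mul_sum, Finset.mul_sum]
  refine Finset.sum_congr rfl fun r hr => ?_
  rw [Finset.mem_range] at hr
  obtain ⟨t, rfl⟩ : ∃ t, n = r + t := ⟨n - r, by omega⟩
  have a1 : 2 * (r + t) + 1 - (r + t + 1 + r) = t := by omega
  have a2 : r + t - r = t := by omega
  have a3 : 2 * (r + t) + 1 - t = r + t + 1 + r := by omega
  have a4 : r + t + 1 + r - 1 = r + t + r := by omega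
  rw [a1, a2, a3, a4]
  have b1 : (X : PowerSeries (ZMod 5)) ^ ((r + t + 1 + r) * (r + t + r)) * (X ^ (2 * (r + t))) ^ t
      = X ^ (3 * (r + t) * (r + t) + (r + t)) * X ^ (r * (r + 1)) := by
    ring
  have b2 : (X : PowerSeries (ZMod 5)) ^ (t * (t - 1)) * (X ^ (2 * (r + t))) ^ (r + t + 1 + r)
      * ((t : PowerSeries (ZMod 5)) * (-1) ^ (t - 1))
      = X ^ (3 * (r + t) * (r + t) + (r + t)) * X ^ (r * (r + 1)) * (-((t : PowerSeries (ZMod 5)) * (-1) ^ t)) := by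
    rcases t with _ | t
    · simp
    · simp only [add_tsub_cancel_right]; ring
  have s1 : ((-1 : PowerSeries (ZMod 5)) ^ t) * (-1) ^ t = 1 := by
    rw [← mul_pow]; simp
  have s2 : ((-1 : PowerSeries (ZMod 5)) ^ r) * (-1) ^ r = 1 := by
    rw [← mul_pow]; simp
  have s3 : (-1 : PowerSeries (ZMod 5)) ^ (r + t) * (-1) ^ (r + t + r) = (-1) ^ r := by
    linear_combination (-1) ^ r * (-1) ^ t * (-1) ^ t * s2 + (-1)^r * s1
  have s4 : (-1 : PowerSeries (ZMod 5)) ^ (r + t) * (-1) ^ t = (-1) ^ r := by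
    linear_combination (-1)^r * s1
  push_cast
  generalize (X : PowerSeries (ZMod 5)) ^ (3 * (r + t) * (r + t) + (r + t)) = Y at *
  generalize (X : PowerSeries (ZMod 5)) ^ (r * (r + 1)) = Z at *
  linear_combination (-(bgI t * bgI (r + t + 1 + r) * (-1) ^ (r + t))) * b2
    + (-(bgI t * bgI (r + t + 1 + r) * (-1) ^ (r + t)) * (r+t+1+r) * (-1) ^ (r + t + r)) * b1
    + (- Y * Z * bgI t * bgI (r + t + 1 + r) * (r+t+1+r)) * s3
    + (Y * Z * bgI t * bgI (r + t + 1 + r) * t) * s4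

lemma bgI_congr (M a : ℕ) (h : M ≤ a) :
    (X : PowerSeries (ZMod 5)) ^ (2 * M + 2) ∣ bgI a - bgI M := by
  induction a, h using Nat.le_induction with
  | base => simp
  | succ a ha ih =>
    have h1 : bgI (a + 1) - bgI M = X ^ (2 * (a + 1)) * bgI (a + 1) + (bgI a - bgI M) := by
      rw [← bgI_succ a]; ring
    rw [h1]
    exact dvd_add (dvd_mul_of_dvd_left (pow_dvd_pow _ (by omega)) _) ih

noncomputable def bgTheta (M : ℕ) : PowerSeries (ZMod 5) :=
  ∑ r ∈ Finset.range (M + 1), (-1) ^ r * (2 * (r : PowerSeries (ZMod 5)) + 1) * X ^ (r * (r + 1))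

lemma bg_theta_congr (M : ℕ) :
    (X : PowerSeries (ZMod 5)) ^ (M + 1) ∣ bgTheta M * bgI M ^ 2 - bgP M ^ 2 * bgI M := by
  have h : bgTheta M * bgI M ^ 2 - bgP M ^ 2 * bgI M
      = ∑ r ∈ Finset.range (M + 1), (-1) ^ r * (2 * (r : PowerSeries (ZMod 5)) + 1) *
        (X ^ (r * (r + 1)) * (bgI M ^ 2 - bgI (M - r) * bgI (M + 1 + r)))
        + bgP M ^ 2 * (bgI (2 * M + 1) - bgI M) := by
    rw [mul_sub, ← bg_jacobi M, bgTheta, Finset.sum_mul]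
    have : ∀ a b c : PowerSeries (ZMod 5), a - c = (a - b) + (b - c) := by intros; ring
    rw [this _ (∑ r ∈ Finset.range (M + 1),
      (-1) ^ r * (2 * (r : PowerSeries (ZMod 5)) + 1) * X ^ (r * (r + 1)) * bgI (M - r) * bgI (M + 1 + r)),
      ← Finset.sum_sub_distrib]
    congr 1
    refine Finset.sum_congr rfl fun r hr => ?_
    ring
  rw [h]
  refine dvd_add (Finset.dvd_sum fun r hr => dvd_mul_of_dvd_right ?_ _) (dvd_mul_of_dvd_right
    ((pow_dvd_pow _ (by omega)).trans (bgI_congr M (2 * M + 1) (by omega))) _)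
  rw [Finset.mem_range] at hr
  have e : (X : PowerSeries (ZMod 5)) ^ (r * (r + 1)) * (bgI M ^ 2 - bgI (M - r) * bgI (M + 1 + r))
      = X ^ (r * (r + 1)) * (bgI M - bgI (M - r)) * bgI M
        - (bgI (M + 1 + r) - bgI M) * (X ^ (r * (r + 1)) * bgI (M - r)) := by ring
  rw [e]
  refine dvd_sub (dvd_mul_of_dvd_left ?_ _) (dvd_mul_of_dvd_left
    ((pow_dvd_pow _ (by omega)).trans (bgI_congr M (M + 1 + r) (by omega))) _)
  refine dvd_trans ?_ (mul_dvd_mul_left _ (bgI_congr (M - r) M (by omega)))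
  rw [← pow_add]
  apply pow_dvd_pow
  have : r ≤ r * (r + 1) := by nlinarith
  omega

lemma bg_coeff_pow5 (f : PowerSeries (ZMod 5)) (m : ℕ) (h : ¬ 5 ∣ m) : coeff m (f ^ 5) = 0 := by
  have h1 : (PowerSeries.map (frobenius (ZMod 5) 5)) (PowerSeries.expand 5 (by norm_num) f) = f ^ 5 :=
    MvPowerSeries.map_frobenius_expand 5 (by norm_num)
  rw [← h1, PowerSeries.coeff_map, PowerSeries.coeff_expand_of_not_dvd _ _ _ h, map_zero]

lemma bg_coeff_zero (M a b s : ℕ) (ha : M ≤ a) (hb : M ≤ b) (hs : s ≤ M) (h5 : s % 5 = 3) :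
    coeff s (bgI a * bgI b) = 0 := by
  have h1 : (X : PowerSeries (ZMod 5)) ^ (M + 1) ∣ bgI a * bgI b - bgTheta M * bgI M ^ 5 := by
    have e : bgI a * bgI b - bgTheta M * bgI M ^ 5
        = (bgI a - bgI M) * bgI b + (bgI b - bgI M) * bgI M
          - (bgTheta M * bgI M ^ 2 - bgP M ^ 2 * bgI M) * bgI M ^ 3 := by
      linear_combination (-(bgI M ^ 2) * (bgP M * bgI M + 1)) * bgP_mul_bgI M
    rw [e]
    refine dvd_sub (dvd_add (dvd_mul_of_dvd_left ?_ _) (dvd_mul_of_dvd_left ?_ _))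
      (dvd_mul_of_dvd_left (bg_theta_congr M) _)
    · exact (pow_dvd_pow _ (by omega)).trans (bgI_congr M a ha)
    · exact (pow_dvd_pow _ (by omega)).trans (bgI_congr M b hb)
  have h2 := X_pow_dvd_iff.1 h1 s (by omega)
  rw [map_sub, sub_eq_zero] at h2
  rw [h2, bgTheta, Finset.sum_mul, map_sum]
  refine Finset.sum_eq_zero fun r hr => ?_
  have e : (-1) ^ r * (2 * (r : PowerSeries (ZMod 5)) + 1) * X ^ (r * (r + 1)) * bgI M ^ 5
      = C ((-1) ^ r * (2 * (r : ZMod 5) + 1)) * (X ^ (r * (r + 1)) * bgI M ^ 5) := by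
    have : (C (2 : ZMod 5) : PowerSeries (ZMod 5)) = 2 := map_ofNat C 2
    simp only [map_mul, map_add, map_pow, map_neg, map_one, map_natCast, this]
    ring
  rw [e, coeff_C_mul, coeff_X_pow_mul']
  split_ifs with hle
  · rw [bg_coeff_pow5, mul_zero]
    intro hd
    have h3 : (r * (r + 1)) % 5 = 3 := by omega
    have h4 : r % 5 < 5 := Nat.mod_lt _ (by norm_num)
    rw [Nat.mul_mod, Nat.add_mod] at h3
    generalize r % 5 = x at *
    interval_cases x <;> simp at h3
  · simp

lemma bgRank_cons (x : ℕ) (l : List ℕ) : bgRank (x :: l) = (x : ℤ) % 2 - bgRank l := by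
  unfold bgRank
  rw [List.length_cons, Finset.sum_range_succ']
  simp only [List.getD_cons_succ, List.getD_cons_zero, pow_succ, pow_zero, one_mul]
  rw [add_comm, sub_eq_add_neg, ← Finset.sum_neg_distrib]
  congr 1
  refine Finset.sum_congr rfl fun i hi => ?_
  ring

def bgS (N n : ℕ) (j : ℤ) : Set (List ℕ) :=
  {l | IsPartition l ∧ (∀ x ∈ l, x ≤ N) ∧ l.sum = n ∧ bgRank l = j}

lemma bgS_zero (n : ℕ) (j : ℤ) : bgS 0 n j = if n = 0 ∧ j = 0 then {[]} else ∅ := by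
  ext l
  rcases l with _ | ⟨x, l⟩
  · split_ifs with h
    · simp [bgS, IsPartition, bgRank, h.1, h.2]
    · simp only [bgS, IsPartition, bgRank, Set.mem_ofPred_eq, Set.mem_empty_iff_false, iff_false]
      intro h'
      simp at h'
      exact h ⟨h'.1.symm, h'.2.symm⟩
  · have : (x :: l) ∉ bgS 0 n j := by
      rintro ⟨⟨_, h1⟩, h2, _⟩
      have := h1 x (by simp)
      have := h2 x (by simp)
      omega
    split_ifs <;> simp [this]

lemma bgS_succ_lt (N n : ℕ) (j : ℤ) (h : n < N + 1) : bgS (N + 1) n j = bgS N n j := by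
  ext l
  constructor
  · rintro ⟨h1, h2, h3, h4⟩
    refine ⟨h1, fun x hx => ?_, h3, h4⟩
    have := List.single_le_sum (l := l) (by simp) x hx
    omega
  · rintro ⟨h1, h2, h3, h4⟩
    exact ⟨h1, fun x hx => (h2 x hx).trans (by omega), h3, h4⟩

lemma bgS_succ_ge (N n : ℕ) (j : ℤ) : bgS (N + 1) (n + (N + 1)) j
    = bgS N (n + (N + 1)) j ∪
      (List.cons (N + 1)) '' bgS (N + 1) n (((N + 1 : ℕ) : ℤ) % 2 - j) := by
  ext l
  constructor
  · rintro ⟨⟨h0, h1⟩, h2, h3, h4⟩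
    rcases l with _ | ⟨x, l⟩
    · simp at h3
    · by_cases hx : x = N + 1
      · right
        subst hx
        rw [bgRank_cons] at h4
        refine ⟨l, ⟨⟨(List.pairwise_cons.1 h0).2, fun y hy => h1 y (by simp [hy])⟩,
          fun y hy => h2 y (by simp [hy]), ?_, by omega⟩, rfl⟩
        simp at h3
        omega
      · left
        refine ⟨⟨h0, h1⟩, ?_, h3, h4⟩
        intro y hy
        have hx' := h2 x (by simp)
        rcases List.mem_cons.1 hy with rfl | hy
        · omega
        · have := (List.pairwise_cons.1 h0).1 y hy
          omega
  · rintro (⟨h1, h2, h3, h4⟩ | ⟨l, ⟨⟨h0, h1⟩, h2, h3, h4⟩, rfl⟩)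
    · exact ⟨h1, fun x hx => (h2 x hx).trans (by omega), h3, h4⟩
    · refine ⟨⟨List.pairwise_cons.2 ⟨fun y hy => h2 y hy, h0⟩, ?_⟩, ?_, ?_, ?_⟩
      · intro y hy
        rcases List.mem_cons.1 hy with rfl | hy
        · omega
        · exact h1 y hy
      · intro y hy
        rcases List.mem_cons.1 hy with rfl | hy
        · omega
        · exact h2 y hy
      · rw [List.sum_cons, h3, add_comm]
      · rw [bgRank_cons, h4]; ring

noncomputable def bgIz (a : ℤ) : PowerSeries (ZMod 5) := if a < 0 then 0 else bgI a.toNat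

lemma bgIz_step (a : ℤ) (h : 0 ≤ a) : (1 - X ^ (2 * a.toNat)) * bgIz a = bgIz (a - 1) := by
  obtain ⟨n, rfl⟩ := Int.eq_ofNat_of_zero_le h
  rcases n with _ | n
  · simp [bgIz]
  · have : ((n + 1 : ℕ) : ℤ) - 1 = (n : ℤ) := by push_cast; ring
    rw [this]
    have h1 : ¬ (((n + 1 : ℕ) : ℤ) < 0) := by omega
    have h2 : ¬ ((n : ℤ) < 0) := by omega
    simp only [bgIz, if_neg h1, if_neg h2, Int.toNat_natCast, bgI_succ]

lemma bgIz_neg (a : ℤ) (h : a < 0) : bgIz a = 0 := by simp [bgIz, h]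

noncomputable def bgC (N : ℕ) (j : ℤ) : PowerSeries (ZMod 5) :=
  X ^ (j * (2 * j - 1)).toNat * (bgIz ((N : ℤ) / 2 + j) * bgIz (((N : ℤ) + 1) / 2 - j))

lemma bg_e_nonneg (j : ℤ) : 0 ≤ j * (2 * j - 1) := by
  rcases le_or_gt j 0 with h | h
  · nlinarith
  · nlinarith

lemma bgC_rec (N : ℕ) (j : ℤ) :
    bgC (N + 1) j = bgC N j + X ^ (N + 1) * bgC (N + 1) (((N + 1 : ℕ) : ℤ) % 2 - j) := by
  unfold bgC
  have e1 := bg_e_nonneg j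
  rcases Nat.even_or_odd' N with ⟨m, rfl | rfl⟩
  · have a0 : ((2 * m + 1 : ℕ) : ℤ) % 2 = 1 := by omega
    have a1 : ((2 * m + 1 : ℕ) : ℤ) / 2 = m := by omega
    have a2 : (((2 * m + 1 : ℕ) : ℤ) + 1) / 2 = m + 1 := by omega
    have a3 : ((2 * m : ℕ) : ℤ) / 2 = m := by omega
    have a4 : (((2 * m : ℕ) : ℤ) + 1) / 2 = m := by omega
    rw [a0, a1, a2, a3, a4, show (m : ℤ) + (1 - j) = m + 1 - j by ring,
      show (m : ℤ) + 1 - (1 - j) = m + j by ring]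
    have e2 := bg_e_nonneg (1 - j)
    rcases lt_or_ge ((m : ℤ) + 1 - j) 0 with h | h
    · rw [bgIz_neg _ h, bgIz_neg (m - j) (by omega)]; simp
    · have h1 := bgIz_step _ h
      rw [show (m : ℤ) + 1 - j - 1 = m - j by ring] at h1
      have h2 : (X : PowerSeries (ZMod 5)) ^ (2 * m + 1) * X ^ ((1 - j) * (2 * (1 - j) - 1)).toNat
          = X ^ (j * (2 * j - 1)).toNat * X ^ (2 * ((m : ℤ) + 1 - j).toNat) := by
        rw [← pow_add, ← pow_add]
        congr 1
        zify
        rw [Int.toNat_of_nonneg e1, Int.toNat_of_nonneg e2, Int.toNat_of_nonneg h]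
        ring
      rw [← h1]
      linear_combination (-(bgIz (m + 1 - j) * bgIz (m + j))) * h2
  · have a0 : ((2 * m + 1 + 1 : ℕ) : ℤ) % 2 = 0 := by omega
    have a1 : ((2 * m + 1 + 1 : ℕ) : ℤ) / 2 = m + 1 := by omega
    have a2 : (((2 * m + 1 + 1 : ℕ) : ℤ) + 1) / 2 = m + 1 := by omega
    have a3 : ((2 * m + 1 : ℕ) : ℤ) / 2 = m := by omega
    have a4 : (((2 * m + 1 : ℕ) : ℤ) + 1) / 2 = m + 1 := by omega
    rw [a0, a1, a2, a3, a4, show (m : ℤ) + 1 + (0 - j) = m + 1 - j by ring,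
      show (m : ℤ) + 1 - (0 - j) = m + 1 + j by ring]
    have e2 := bg_e_nonneg (0 - j)
    rcases lt_or_ge ((m : ℤ) + 1 + j) 0 with h | h
    · rw [bgIz_neg _ h, bgIz_neg (m + j) (by omega)]; simp
    · have h1 := bgIz_step _ h
      rw [show (m : ℤ) + 1 + j - 1 = m + j by ring] at h1
      have h2 : (X : PowerSeries (ZMod 5)) ^ (2 * m + 1 + 1) * X ^ ((0 - j) * (2 * (0 - j) - 1)).toNat
          = X ^ (j * (2 * j - 1)).toNat * X ^ (2 * ((m : ℤ) + 1 + j).toNat) := by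
        rw [← pow_add, ← pow_add]
        congr 1
        zify
        rw [Int.toNat_of_nonneg e1, Int.toNat_of_nonneg e2, Int.toNat_of_nonneg h]
        ring
      rw [← h1]
      linear_combination (-(bgIz (m + 1 - j) * bgIz (m + 1 + j))) * h2

lemma bgC_zero (j : ℤ) : bgC 0 j = if j = 0 then 1 else 0 := by
  unfold bgC
  split_ifs with h
  · subst h
    simp [bgIz, bgI_zero]
  · rcases lt_or_gt_of_ne h with h | h
    · rw [bgIz_neg (((0 : ℕ) : ℤ) / 2 + j) (by simpa using h)]; simp
    · rw [bgIz_neg ((((0 : ℕ) : ℤ) + 1) / 2 - j) (by simpa using h)]; simp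

lemma bg_main (N n : ℕ) (j : ℤ) :
    (bgS N n j).Finite ∧ ((bgS N n j).ncard : ZMod 5) = coeff n (bgC N j) := by
  induction N generalizing n j with
  | zero =>
    rw [bgS_zero, bgC_zero]
    by_cases hj : j = 0 <;> by_cases hn : n = 0 <;> simp [hj, hn, coeff_one]
  | succ N ihN =>
    induction n using Nat.strong_induction_on generalizing j with
    | _ n ihn =>
      rw [bgC_rec, map_add, coeff_X_pow_mul']
      rcases lt_or_ge n (N + 1) with h | h
      · rw [bgS_succ_lt _ _ _ h, if_neg (by omega), add_zero]
        exact ihN n j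
      · obtain ⟨k, rfl⟩ := Nat.exists_eq_add_of_le' h
        rw [if_pos h, bgS_succ_ge, add_tsub_cancel_right]
        obtain ⟨f1, c1⟩ := ihN (k + (N + 1)) j
        obtain ⟨f2, c2⟩ := ihn k (by omega) (((N + 1 : ℕ) : ℤ) % 2 - j)
        have f3 := f2.image (List.cons (N + 1))
        refine ⟨f1.union f3, ?_⟩
        rw [Set.ncard_union_eq _ f1 f3, Set.ncard_image_of_injective _ List.cons_injective,
          Nat.cast_add, c1, c2]
        rw [Set.disjoint_left]
        rintro l ⟨_, h2, _⟩ ⟨l', _, rfl⟩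
        have := h2 (N + 1) (by simp)
        omega

theorem pj_five_mul_add_three_cong (n : ℕ) (j : ℤ)
    (hj : j % 5 = 0 ∨ j % 5 = 3) :
    (5 : ℕ) ∣ pj j (5 * n + 3) := by
  set m := 5 * n + 3 + j.natAbs with hm
  have h1 : pj j (5 * n + 3) = (bgS (2 * m) (5 * n + 3) j).ncard := by
    have : bgS (2 * m) (5 * n + 3) j
        = {l : List ℕ | IsPartition l ∧ l.sum = 5 * n + 3 ∧ bgRank l = j} := by
      ext l
      constructor
      · rintro ⟨h1, h2, h3, h4⟩
        exact ⟨h1, h3, h4⟩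
      · rintro ⟨h1, h3, h4⟩
        refine ⟨h1, fun x hx => ?_, h3, h4⟩
        have := List.single_le_sum (l := l) (by simp) x hx
        omega
    rw [this]
    rfl
  rw [← ZMod.natCast_eq_zero_iff, h1, (bg_main _ _ _).2, bgC, coeff_X_pow_mul']
  split_ifs with hle
  · have a1 : ((2 * m : ℕ) : ℤ) / 2 + j = ((m + j).toNat : ℕ) := by omega
    have a2 : (((2 * m : ℕ) : ℤ) + 1) / 2 - j = ((m - j).toNat : ℕ) := by omega
    have b : ∀ k : ℕ, bgIz (k : ℤ) = bgI k := by
      intro k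
      have : ¬ ((k : ℤ) < 0) := by omega
      simp [bgIz, this]
    rw [a1, a2, b, b]
    refine bg_coeff_zero (5 * n + 3) _ _ _ (by omega) (by omega) (by omega) ?_
    have e1 := bg_e_nonneg j
    have e2 : (j * (2 * j - 1)) % 5 = 0 := by
      apply Int.emod_eq_zero_of_dvd
      rcases hj with h | h
      · exact dvd_mul_of_dvd_left (by omega) _
      · exact dvd_mul_of_dvd_right (by omega) _
    omega
  · rfl
end
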